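/- arXiv:math/0211327 — 5 statements merged into one kernel-verified Lean document; each statement's English description precedes it below -/
import Mathlib

section
/- Let μ ∈ ℤ^n be GL_n-dominant, let ν ∈ ℤ^n be M-dominant and M-minuscule with respect to (n_1,…,n_r), and suppose ν_M is GL_n-dominant, S_i(ν_M) ≤ S_i(μ) for all 1 ≤ i < n, and S_n(ν_M) = S_n(μ). Then there exist an integer s ≥ 1, positive integers m_1,…,m_s with m_1+⋯+m_s = n, and a vector η ∈ ℤ^n whose entries are a rearrangement (permutation) of the entries of ν, such that: η_1 ≥ η_2 ≥ ⋯ ≥ η_n; any two entries of η lying in the same batch of the partition (m_1,…,m_s) differ by at most 1; and the batch-average vector η_L of η with respect to (m_1,…,m_s) satisfies S_i(η_L) ≤ S_i(μ) for all 1 ≤ i < n and S_n(η_L) = S_n(μ). -/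
open Finset

/-- `sig c k = c 0 + c 1 + ⋯ + c (k-1)`, i.e. `σ(k) = n₁ + ⋯ + n_k`. -/
def sig (c : ℕ → ℕ) (k : ℕ) : ℕ := ∑ i ∈ Finset.range k, c i

/-- The (0-based) index of the batch containing position `i`
(positions `≥ sig c r` get index `r`, the "final batch"). -/
def batchIdx (c : ℕ → ℕ) (r i : ℕ) : ℕ :=
  Nat.findGreatest (fun k => sig c k ≤ i) r

/-- partial sum `S_i(x) = x_0 + ⋯ + x_{i-1}` (1-based: the sum of the first `i` entries). -/
def psum {α : Type*} [AddCommMonoid α] (x : ℕ → α) (i : ℕ) : α :=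
  ∑ m ∈ Finset.range i, x m

/-- The batch-average vector: every entry of a batch is replaced by that batch's average;
entries of the final batch (positions `≥ sig c r`, if any) are replaced by `0`. -/
def avgVec (c : ℕ → ℕ) (r n : ℕ) (ν : ℕ → ℤ) (i : ℕ) : ℚ :=
  if sig c r ≤ i then 0
  else (∑ m ∈ Finset.range n, if batchIdx c r m = batchIdx c r i then (ν m : ℚ) else 0) /
       (∑ m ∈ Finset.range n, if batchIdx c r m = batchIdx c r i then (1 : ℚ) else 0)

/-- The average of `x` over the fibre of `b` through `i`, within the first `n` positions. -/
def fiberAvg (b : ℕ → ℤ) (n : ℕ) (x : ℕ → ℚ) (i : ℕ) : ℚ :=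
  (∑ m ∈ range n with b m = b i, x m) / #{m ∈ range n | b m = b i}

theorem card_fiber_pos (b : ℕ → ℤ) {n i : ℕ} (hi : i < n) :
    (0 : ℚ) < #{m ∈ range n | b m = b i} := by
  have : 0 < #{m ∈ range n | b m = b i} :=
    card_pos.2 ⟨i, by simp [hi]⟩
  exact_mod_cast this

theorem sum_fiber_fiberAvg (b : ℕ → ℤ) (n : ℕ) (x : ℕ → ℚ) (v : ℤ) :
    ∑ i ∈ range n with b i = v, fiberAvg b n x i = ∑ i ∈ range n with b i = v, x i := by
  rcases (filter (fun i => b i = v) (range n)).eq_empty_or_nonempty with h | ⟨j, hj⟩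
  · rw [h, sum_empty, sum_empty]
  obtain ⟨hjn, rfl⟩ := mem_filter.1 hj
  have hc := card_fiber_pos b (mem_range.1 hjn)
  have : ∀ i ∈ filter (fun i => b i = b j) (range n), fiberAvg b n x i = fiberAvg b n x j := by
    intro i hi
    simp only [fiberAvg, (mem_filter.1 hi).2]
  rw [sum_congr rfl this, sum_const, nsmul_eq_mul, fiberAvg, mul_div_cancel₀ _ hc.ne']

/-- Averaging over the fibres of `b` preserves sums over the fibres of any coarser map `f`. -/
theorem sum_fiber_fiberAvg_of_refines (b f : ℕ → ℤ) (n : ℕ) (x : ℕ → ℚ)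
    (h : ∀ i < n, ∀ j < n, b i = b j → f i = f j) (v : ℤ) :
    ∑ i ∈ range n with f i = v, fiberAvg b n x i = ∑ i ∈ range n with f i = v, x i := by
  have key : ∀ y : ℕ → ℚ, ∑ i ∈ range n with f i = v, y i =
      ∑ w ∈ image b (filter (fun i => f i = v) (range n)), ∑ i ∈ range n with b i = w, y i := by
    intro y
    rw [← sum_fiberwise_of_maps_to (g := b) (fun i hi => mem_image_of_mem b hi)]
    refine sum_congr rfl fun w hw => sum_congr ?_ fun _ _ => rfl
    obtain ⟨j, hj, rfl⟩ := mem_image.1 hw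
    obtain ⟨hjn, rfl⟩ := mem_filter.1 hj
    ext i
    simp only [mem_filter, mem_range] at *
    exact ⟨fun hi => ⟨hi.1.1, hi.2⟩, fun hi => ⟨⟨hi.1, h i hi.1 j hjn hi.2⟩, hi.2⟩⟩
  rw [key, key]
  exact sum_congr rfl fun w _ => sum_fiber_fiberAvg b n x w

/-- Averaging a nonincreasing vector over fibres lowers its partial sums. -/
theorem sum_range_fiberAvg_le (f : ℕ → ℤ) {n j : ℕ} (a : ℕ → ℚ) (hj : j ≤ n)
    (ha : ∀ i i', i ≤ i' → i' < n → a i' ≤ a i) :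
    ∑ i ∈ range j, fiberAvg f n a i ≤ ∑ i ∈ range j, a i := by
  have hm : ∀ i ∈ range j, f i ∈ image f (range j) := fun i hi => mem_image_of_mem f hi
  rw [← sum_fiberwise_of_maps_to hm, ← sum_fiberwise_of_maps_to hm]
  refine sum_le_sum fun w hw => ?_
  obtain ⟨k, hk, rfl⟩ := mem_image.1 hw
  have hkn : k < n := (mem_range.1 hk).trans_le hj
  have hc := card_fiber_pos f hkn
  have hconst : ∀ i ∈ filter (fun i => f i = f k) (range j),
      fiberAvg f n a i = fiberAvg f n a k := by
    intro i hi
    simp only [fiberAvg, (mem_filter.1 hi).2]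
  rw [sum_congr rfl hconst, sum_const, nsmul_eq_mul, fiberAvg, ← mul_div_assoc, div_le_iff₀ hc]
  set F := filter (fun i => f i = f k) (range n) with hF
  set E := filter (fun i => f i = f k) (range j) with hE
  have hEF : E ⊆ F := filter_subset_filter _ (range_subset_range.2 hj)
  have h1 : 0 ≤ ∑ x ∈ E, ∑ y ∈ F \ E, (a x - a y) := by
    refine sum_nonneg fun x hx => sum_nonneg fun y hy => ?_
    simp only [hE, hF, mem_sdiff, mem_filter, mem_range] at hx hy
    have := ha x y (by grind) hy.1.1
    linarith
  have h2 : ∑ x ∈ E, ∑ y ∈ E, (a x - a y) = 0 := by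
    simp only [sum_sub_distrib, sum_const, nsmul_eq_mul]
    rw [← mul_sum]
    ring
  have h3 : ∑ x ∈ E, ∑ y ∈ F, (a x - a y) = (∑ x ∈ E, a x) * #F - #E * ∑ y ∈ F, a y := by
    simp only [sum_sub_distrib, sum_const, nsmul_eq_mul]
    rw [← mul_sum]
    ring
  have h4 : ∑ x ∈ E, ∑ y ∈ F, (a x - a y) =
      ∑ x ∈ E, ∑ y ∈ F \ E, (a x - a y) + ∑ x ∈ E, ∑ y ∈ E, (a x - a y) := by
    rw [← sum_add_distrib]
    exact sum_congr rfl fun x _ => (sum_sdiff hEF).symm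
  linarith

theorem sum_range_fiberAvg (f : ℕ → ℤ) (n : ℕ) (a : ℕ → ℚ) :
    ∑ i ∈ range n, fiberAvg f n a i = ∑ i ∈ range n, a i := by
  have hm : ∀ i ∈ range n, f i ∈ image f (range n) := fun i hi => mem_image_of_mem f hi
  rw [← sum_fiberwise_of_maps_to hm, ← sum_fiberwise_of_maps_to hm]
  exact sum_congr rfl fun w _ => sum_fiber_fiberAvg f n a w

theorem floor_fiberAvg_bounds (b : ℕ → ℤ) {n i : ℕ} (x : ℕ → ℤ) (hi : i < n)
    (h : ∀ m < n, b m = b i → x m ≤ x i + 1 ∧ x i ≤ x m + 1) :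
    ⌊fiberAvg b n (fun m => (x m : ℚ)) i⌋ ≤ x i ∧
      x i ≤ ⌊fiberAvg b n (fun m => (x m : ℚ)) i⌋ + 1 := by
  have hc := card_fiber_pos b hi
  constructor
  · rw [← Int.lt_add_one_iff, Int.floor_lt, fiberAvg, div_lt_iff₀ hc, mul_comm, ← nsmul_eq_mul,
      ← sum_const]
    refine sum_lt_sum (fun m hm => ?_) ⟨i, by simp [hi], by push_cast; linarith⟩
    simp only [mem_filter, mem_range] at hm
    exact_mod_cast (h m hm.1 hm.2).1
  · rw [← sub_le_iff_le_add, Int.le_floor, fiberAvg, le_div_iff₀ hc, mul_comm, ← nsmul_eq_mul,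
      ← sum_const]
    refine sum_le_sum fun m hm => ?_
    simp only [mem_filter, mem_range] at hm
    exact_mod_cast sub_le_iff_le_add.2 (h m hm.1 hm.2).2

theorem avgVec_eq_fiberAvg {c : ℕ → ℕ} {r n : ℕ} (hn : sig c r = n) (b : ℕ → ℤ)
    (hb : ∀ i < n, ∀ j < n, batchIdx c r i = batchIdx c r j ↔ b i = b j) (x : ℕ → ℤ)
    {i : ℕ} (hi : i < n) : avgVec c r n x i = fiberAvg b n (fun m => (x m : ℚ)) i := by
  have hF : filter (fun m => batchIdx c r m = batchIdx c r i) (range n) =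
      filter (fun m => b m = b i) (range n) :=
    filter_congr fun m hm => hb m (mem_range.1 hm) i hi
  rw [avgVec, if_neg (by omega), fiberAvg, ← sum_filter, ← sum_filter, hF]
  simp

theorem batchIdx_congr {c d : ℕ → ℕ} {i r : ℕ} (h : ∀ k ≤ r, sig c k = sig d k) :
    batchIdx c r i = batchIdx d r i := by
  induction r with
  | zero => rfl
  | succ r ih =>
    have := ih fun k hk => h k (by omega)
    unfold batchIdx at *
    rw [Nat.findGreatest_succ, Nat.findGreatest_succ, this, h (r + 1) le_rfl]

theorem batchIdx_succ_of_lt {c : ℕ → ℕ} {i r : ℕ} (h : i < sig c (r + 1)) :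
    batchIdx c (r + 1) i = batchIdx c r i := by
  unfold batchIdx
  rw [Nat.findGreatest_succ, if_neg (by omega)]

theorem batchIdx_of_le {c : ℕ → ℕ} {i r : ℕ} (h : sig c r ≤ i) : batchIdx c r i = r := by
  cases r with
  | zero => rfl
  | succ r =>
    unfold batchIdx
    rw [Nat.findGreatest_succ, if_pos h]

theorem sig_update_of_le (d : ℕ → ℕ) {k t : ℕ} (h : k ≤ t) (v : ℕ) :
    sig (Function.update d t v) k = sig d k := by
  unfold sig
  refine sum_congr rfl fun i hi => Function.update_of_ne ?_ _ _
  have := mem_range.1 hi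
  omega

theorem sig_update_succ (d : ℕ → ℕ) (t v : ℕ) :
    sig (Function.update d t v) (t + 1) = sig d t + v := by
  have := sig_update_of_le d (le_refl t) v
  unfold sig at *
  rw [sum_range_succ, this, Function.update_self]

/-- The level sets of a nonincreasing function on the first `n` positions are the batches of
a composition of `n`. -/
theorem exists_composition_of_antitone (f : ℕ → ℤ) (n : ℕ) (hn : 1 ≤ n)
    (hf : ∀ i i', i ≤ i' → i' < n → f i' ≤ f i) :
    ∃ (t : ℕ) (d : ℕ → ℕ), (∀ k < t + 1, 0 < d k) ∧ sig d (t + 1) = n ∧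
      ∀ i < n, ∀ j < n, batchIdx d (t + 1) i = batchIdx d (t + 1) j ↔ f i = f j := by
  induction n, hn using Nat.le_induction with
  | base =>
    refine ⟨0, fun _ => 1, fun _ _ => one_pos, by simp [sig], fun i hi j hj => ?_⟩
    obtain rfl : i = 0 := by omega
    obtain rfl : j = 0 := by omega
    simp
  | succ n hn ih =>
    obtain ⟨t, d, hd, hsig, hb⟩ := ih fun i i' h h' => hf i i' h (by omega)
    have hsucc : sig d (t + 1) = sig d t + d t := sum_range_succ _ _
    have hdt := hd t (by omega)
    by_cases hfn : f n = f (n - 1)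
    · have hs : sig (Function.update d t (d t + 1)) (t + 1) = n + 1 := by
        rw [sig_update_succ]; omega
      have hidx : ∀ i < n + 1, batchIdx (Function.update d t (d t + 1)) (t + 1) i =
          batchIdx d t i := fun i hi => by
        rw [batchIdx_succ_of_lt (by omega), batchIdx_congr fun k hk => sig_update_of_le d hk _]
      have hlast : batchIdx d t n = batchIdx d t (n - 1) := by
        rw [batchIdx_of_le (by omega), batchIdx_of_le (by omega)]
      have hb' : ∀ i < n, ∀ j < n, batchIdx d t i = batchIdx d t j ↔ f i = f j := by
        intro i hi j hj
        rw [← hb i hi j hj, batchIdx_succ_of_lt (by omega), batchIdx_succ_of_lt (by omega)]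
      refine ⟨t, Function.update d t (d t + 1), fun k hk => ?_, hs, fun i hi j hj => ?_⟩
      · rcases eq_or_ne k t with rfl | h
        · simp
        · rw [Function.update_of_ne h]
          exact hd k hk
      · rw [hidx i hi, hidx j hj]
        rcases Nat.lt_succ_iff_lt_or_eq.1 hi with hi | rfl <;>
          rcases Nat.lt_succ_iff_lt_or_eq.1 hj with hj | rfl
        · exact hb' i hi j hj
        · rw [hlast, hfn]
          exact hb' i hi _ (by omega)
        · rw [hlast, hfn]
          exact hb' _ (by omega) j hj
        · simp
    · have hs : sig (Function.update d (t + 1) 1) (t + 1 + 1) = n + 1 := by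
        rw [sig_update_succ, hsig]
      have hidx : ∀ i < n + 1, batchIdx (Function.update d (t + 1) 1) (t + 1 + 1) i =
          batchIdx d (t + 1) i := fun i hi => by
        rw [batchIdx_succ_of_lt (by omega), batchIdx_congr fun k hk => sig_update_of_le d hk _]
      have hlast : batchIdx d (t + 1) n = t + 1 := batchIdx_of_le hsig.le
      have hlt : ∀ i < n, batchIdx d (t + 1) i ≠ t + 1 := fun i hi => by
        rw [batchIdx_succ_of_lt (by omega)]
        exact (Nat.lt_succ_of_le (Nat.findGreatest_le _)).ne
      have hne : ∀ i < n, f i ≠ f n := fun i hi => by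
        have h1 := hf i (n - 1) (by omega) (by omega)
        have h2 := hf (n - 1) n (by omega) (by omega)
        omega
      refine ⟨t + 1, Function.update d (t + 1) 1, fun k hk => ?_, hs, fun i hi j hj => ?_⟩
      · rcases eq_or_ne k (t + 1) with rfl | h
        · simp
        · rw [Function.update_of_ne h]
          exact hd k (by omega)
      · rw [hidx i hi, hidx j hj]
        rcases Nat.lt_succ_iff_lt_or_eq.1 hi with hi | rfl <;>
          rcases Nat.lt_succ_iff_lt_or_eq.1 hj with hj | rfl
        · exact hb i hi j hj
        · rw [hlast]
          exact iff_of_false (hlt i hi) (hne i hi)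
        · rw [hlast]
          exact iff_of_false (hlt j hj).symm (hne j hj).symm
        · simp

/-- A vector can be sorted inside each level set of a nonincreasing function. -/
theorem exists_perm_sorting_levels (f x : ℕ → ℤ) (n : ℕ)
    (hf : ∀ i i', i ≤ i' → i' < n → f i' ≤ f i) :
    ∃ π : Equiv.Perm ℕ, (∀ i, π i < n ↔ i < n) ∧ (∀ i < n, f (π i) = f i) ∧
      ∀ i i', i ≤ i' → i' < n → f i = f i' → x (π i') ≤ x (π i) := by
  let g : Fin n → ℤ ×ₗ ℤ := fun i => toLex (-f i, -x i)
  let σ := Tuple.sort g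
  have hσ : Monotone (g ∘ σ) := Tuple.monotone_sort g
  have hfσ : (fun i : Fin n => -f i) ∘ σ = (fun i : Fin n => -f i) ∘ (1 : Equiv.Perm (Fin n)) := by
    refine Tuple.unique_monotone (fun i j hij => ?_) fun i j hij => ?_
    · have := hσ hij
      simp only [g, Function.comp_apply, Prod.Lex.toLex_le_toLex] at this
      rcases this with h | h
      · exact h.le
      · exact h.1.le
    · simpa using hf i j hij j.2
  have hfσ' : ∀ i : Fin n, f (σ i) = f i := fun i => by simpa using congrFun hfσ i
  let π : Equiv.Perm ℕ := σ.extendDomain (Fin.equivSubtype (n := n))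
  have hπ : ∀ i (hi : i < n), π i = σ ⟨i, hi⟩ := fun i hi =>
    σ.extendDomain_apply_subtype Fin.equivSubtype hi
  refine ⟨π, fun i => ?_, fun i hi => ?_, fun i i' h hi' hff => ?_⟩
  · by_cases hi : i < n
    · simp [hπ i hi, hi]
    · rw [σ.extendDomain_apply_not_subtype Fin.equivSubtype hi]
  · rw [hπ i hi, hfσ']
  · have := hσ (show (⟨i, h.trans_lt hi'⟩ : Fin n) ≤ ⟨i', hi'⟩ from h)
    simp only [g, Function.comp_apply, Prod.Lex.toLex_le_toLex, hfσ', hff] at this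
    rw [hπ i (h.trans_lt hi'), hπ i' hi']
    simpa using this

theorem sum_fiber_comp_perm (f : ℕ → ℤ) (n : ℕ) (x : ℕ → ℚ) (π : Equiv.Perm ℕ)
    (hπ : ∀ i, π i < n ↔ i < n) (hf : ∀ i < n, f (π i) = f i) (v : ℤ) :
    ∑ i ∈ range n with f i = v, x (π i) = ∑ i ∈ range n with f i = v, x i := by
  refine sum_equiv π (fun i => ?_) fun _ _ => rfl
  simp only [mem_filter, mem_range, hπ]
  exact and_congr_right fun hi => by rw [hf i hi]

theorem stmt2 (n r : ℕ) (hr : 0 < r) (c : ℕ → ℕ)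
    (hpos : ∀ k < r, 0 < c k) (hsum : sig c r = n)
    (μ ν : ℕ → ℤ)
    -- μ is GL_n-dominant
    (hμ : ∀ i i', i ≤ i' → i' < n → μ i' ≤ μ i)
    -- ν is M-dominant and M-minuscule
    (hM : ∀ i i', i ≤ i' → i' < n → batchIdx c r i = batchIdx c r i' →
      ν i' ≤ ν i ∧ ν i ≤ ν i' + 1)
    -- ν_M is GL_n-dominant
    (hdom : ∀ i i', i ≤ i' → i' < n → avgVec c r n ν i' ≤ avgVec c r n ν i)
    -- S_i(ν_M) ≤ S_i(μ) for 1 ≤ i < n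
    (hle : ∀ i, 1 ≤ i → i < n →
      psum (avgVec c r n ν) i ≤ psum (fun m => (μ m : ℚ)) i)
    -- S_n(ν_M) = S_n(μ)
    (heq : psum (avgVec c r n ν) n = psum (fun m => (μ m : ℚ)) n) :
    ∃ (s : ℕ) (d : ℕ → ℕ) (η : ℕ → ℤ) (π : Equiv.Perm ℕ),
      1 ≤ s ∧ (∀ k < s, 0 < d k) ∧ sig d s = n ∧
      -- η is a rearrangement of the entries of ν
      (∀ i < n, π i < n) ∧ (∀ i < n, η i = ν (π i)) ∧
      -- η is nonincreasing
      (∀ i i', i ≤ i' → i' < n → η i' ≤ η i) ∧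
      -- entries of η in the same batch of (m_1, …, m_s) differ by at most 1
      (∀ i i', i < n → i' < n → batchIdx d s i = batchIdx d s i' →
        |η i - η i'| ≤ 1) ∧
      -- S_i(η_L) ≤ S_i(μ) for 1 ≤ i < n, and S_n(η_L) = S_n(μ)
      (∀ i, 1 ≤ i → i < n →
        psum (avgVec d s n η) i ≤ psum (fun m => (μ m : ℚ)) i) ∧
      psum (avgVec d s n η) n = psum (fun m => (μ m : ℚ)) n := by
  have hn : 1 ≤ n := by
    rw [← hsum]
    exact (hpos 0 hr).trans_le (single_le_sum (fun _ _ => Nat.zero_le _) (mem_range.2 hr))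
  set a : ℕ → ℚ := avgVec c r n ν with ha
  let b : ℕ → ℤ := fun i => (batchIdx c r i : ℤ)
  let f : ℕ → ℤ := fun i => ⌊a i⌋
  have hab : ∀ i < n, a i = fiberAvg b n (fun m => (ν m : ℚ)) i := fun i hi =>
    avgVec_eq_fiberAvg hsum b (fun _ _ _ _ => by simp [b]) ν hi
  have hbf : ∀ i < n, ∀ j < n, b i = b j → f i = f j := by
    intro i hi j hj h
    simp only [f]
    rw [hab i hi, hab j hj]
    simp only [fiberAvg, h]
  have hν : ∀ i < n, f i ≤ ν i ∧ ν i ≤ f i + 1 := by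
    intro i hi
    simp only [f]
    rw [hab i hi]
    refine floor_fiberAvg_bounds b ν hi fun m hm h => ?_
    have h : batchIdx c r m = batchIdx c r i := Int.ofNat_inj.1 h
    rcases le_total m i with hmi | hmi
    · have := hM m i hmi hi h
      omega
    · have := hM i m hmi hm h.symm
      omega
  have hf : ∀ i i', i ≤ i' → i' < n → f i' ≤ f i := fun i i' h h' =>
    Int.floor_mono (hdom i i' h h')
  obtain ⟨t, d, hd, hsig, hdf⟩ := exists_composition_of_antitone f n hn hf
  obtain ⟨π, hπ, hfπ, hsort⟩ := exists_perm_sorting_levels f ν n hf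
  have hη : ∀ i < n, f i ≤ ν (π i) ∧ ν (π i) ≤ f i + 1 := fun i hi => by
    have := hν (π i) ((hπ i).2 hi)
    rwa [hfπ i hi] at this
  have havg : ∀ i < n, avgVec d (t + 1) n (fun m => ν (π m)) i = fiberAvg f n a i := by
    intro i hi
    have h1 : ∑ m ∈ range n with f m = f i, a m = ∑ m ∈ range n with f m = f i, (ν m : ℚ) := by
      rw [← sum_fiber_fiberAvg_of_refines b f n (fun m => (ν m : ℚ)) hbf]
      exact sum_congr rfl fun m hm => hab m (mem_range.1 (mem_filter.1 hm).1)
    rw [avgVec_eq_fiberAvg hsig f hdf _ hi, fiberAvg, fiberAvg, h1,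
      sum_fiber_comp_perm f n (fun m => (ν m : ℚ)) π hπ hfπ]
  have hpsum : ∀ j ≤ n, psum (avgVec d (t + 1) n fun m => ν (π m)) j =
      ∑ i ∈ range j, fiberAvg f n a i := fun j hj =>
    sum_congr rfl fun i hi => havg i ((mem_range.1 hi).trans_le hj)
  refine ⟨t + 1, d, fun i => ν (π i), π, by omega, hd, hsig, fun i hi => (hπ i).2 hi,
    fun _ _ => rfl, fun i i' h h' => ?_, fun i i' hi hi' h => ?_, fun j hj hjn => ?_, ?_⟩
  · rcases (hf i i' h h').eq_or_lt with he | hlt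
    · exact hsort i i' h h' he.symm
    · have h1 := hη i (h.trans_lt h')
      have h2 := hη i' h'
      show ν (π i') ≤ ν (π i)
      omega
  · have h1 := hη i hi
    have h2 := hη i' hi'
    have h3 := (hdf i hi i' hi').1 h
    rw [abs_le]
    constructor <;> linarith
  · rw [hpsum j hjn.le]
    exact (sum_range_fiberAvg_le f a hjn.le hdom).trans (hle j hj hjn)
  · rw [hpsum n le_rfl, sum_range_fiberAvg]
    exact heq
end

section
/- Let μ ∈ ℤ^n be GL_n-dominant and let ν ∈ ℤ^n satisfy: ν_1 ≥ ν_2 ≥ ⋯ ≥ ν_n (ν is GL_n-dominant); any two entries of ν in the same batch of (n_1,…,n_r) differ by at most 1 (ν is M-minuscule); S_i(ν_M) ≤ S_i(μ) for all 1 ≤ i < n; and S_n(ν) = S_n(μ). Then S_i(ν) ≤ S_i(μ) for all 1 ≤ i < n, i.e. ν ≤ μ; in particular ν lies in the convex hull of the orbit of μ under coordinate permutations. -/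
open Finset

theorem sig_mono (c : ℕ → ℕ) : Monotone (sig c) := fun _ _ h =>
  Finset.sum_le_sum_of_subset (Finset.range_mono h)

theorem sig_succ (c : ℕ → ℕ) (k : ℕ) : sig c (k + 1) = sig c k + c k :=
  Finset.sum_range_succ _ _

/-- The index of a proper batch is characterized by the boundaries. -/
theorem batchIdx_eq_iff {c : ℕ → ℕ} {r i k : ℕ} (hk : k < r) :
    batchIdx c r i = k ↔ sig c k ≤ i ∧ i < sig c (k + 1) := by
  constructor
  · intro h
    constructor
    · have := Nat.findGreatest_spec (P := fun k => sig c k ≤ i) (Nat.zero_le r) (by simp [sig])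
      rwa [show Nat.findGreatest (fun k => sig c k ≤ i) r = k from h] at this
    · by_contra! hlt
      have := Nat.le_findGreatest (P := fun k => sig c k ≤ i) (Nat.succ_le_of_lt hk) hlt
      unfold batchIdx at h
      omega
  · rintro ⟨h1, h2⟩
    refine Nat.findGreatest_eq_iff.2 ⟨hk.le, fun _ => h1, fun m hm _ hle => ?_⟩
    have := sig_mono c (Nat.succ_le_of_lt hm)
    simp only [Nat.succ_eq_add_one] at this
    omega

theorem exists_batch {c : ℕ → ℕ} {r i : ℕ} (hi : i < sig c r) :
    ∃ k < r, sig c k ≤ i ∧ i < sig c (k + 1) := by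
  induction r with
  | zero => simp [sig] at hi
  | succ r ih =>
    by_cases h : i < sig c r
    · obtain ⟨k, hk, h'⟩ := ih h
      exact ⟨k, hk.trans (Nat.lt_succ_self r), h'⟩
    · exact ⟨r, Nat.lt_succ_self r, not_lt.1 h, hi⟩

/-- Batch averaging does not change the partial sums at the batch boundaries. -/
theorem psum_avgVec_sig {c : ℕ → ℕ} {r : ℕ} (hpos : ∀ k < r, 0 < c k) (ν : ℕ → ℤ) {k : ℕ}
    (hk : k ≤ r) :
    psum (avgVec c r (sig c r) ν) (sig c k) = ((psum ν (sig c k) : ℤ) : ℚ) := by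
  induction k with
  | zero => simp [psum, sig]
  | succ k ih =>
    have hkr : k < r := hk
    have hle : sig c k ≤ sig c (k + 1) := sig_mono c k.le_succ
    have hn : sig c (k + 1) ≤ sig c r := sig_mono c hk
    have hfilter {i : ℕ} (hi : batchIdx c r i = k) :
        (Finset.range (sig c r)).filter (fun m => batchIdx c r m = batchIdx c r i) =
          Finset.Ico (sig c k) (sig c (k + 1)) := by
      ext m
      simp only [Finset.mem_filter, Finset.mem_range, Finset.mem_Ico, hi]
      constructor
      · rintro ⟨_, h⟩
        exact (batchIdx_eq_iff hkr).1 h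
      · intro h
        exact ⟨h.2.trans_le hn, (batchIdx_eq_iff hkr).2 h⟩
    have havg : ∀ i ∈ Finset.Ico (sig c k) (sig c (k + 1)), avgVec c r (sig c r) ν i =
        (∑ m ∈ Finset.Ico (sig c k) (sig c (k + 1)), (ν m : ℚ)) / (c k : ℚ) := by
      intro i hi
      rw [Finset.mem_Ico] at hi
      have hlt := hi.2.trans_le hn
      have hi' := (batchIdx_eq_iff hkr).2 hi
      rw [avgVec, if_neg hlt.not_ge, ← Finset.sum_filter, ← Finset.sum_filter, hfilter hi']
      simp [sig_succ]
    have hc : (c k : ℚ) ≠ 0 := by exact_mod_cast (hpos k hkr).ne'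
    have ih' := ih hkr.le
    unfold psum at ih' ⊢
    rw [← Finset.sum_range_add_sum_Ico _ hle, ← Finset.sum_range_add_sum_Ico _ hle, ih',
      Finset.sum_congr rfl havg, Finset.sum_const, Nat.card_Ico, sig_succ, Nat.add_sub_cancel_left,
      nsmul_eq_mul, mul_div_cancel₀ _ hc]
    push_cast
    rfl

/-- If `μ` is weakly decreasing and `ν` varies by at most one on `[a, b)`, then the inequality
of partial sums at the end points `a` and `b` propagates to every point in between. -/
theorem psum_le_psum_of_endpoints {μ ν : ℕ → ℤ} {a b i : ℕ} (hai : a ≤ i) (hib : i ≤ b)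
    (hμ : ∀ m m', m ≤ m' → m' < b → μ m' ≤ μ m)
    (hν : ∀ m m', a ≤ m → m < b → a ≤ m' → m' < b → ν m - ν m' ≤ 1)
    (ha : psum ν a ≤ psum μ a) (hb : psum ν b ≤ psum μ b) : psum ν i ≤ psum μ i := by
  by_contra! h
  have hleft : ∑ m ∈ Finset.Ico a i, μ m < ∑ m ∈ Finset.Ico a i, ν m := by
    unfold psum at ha h
    rw [← Finset.sum_range_add_sum_Ico _ hai, ← Finset.sum_range_add_sum_Ico _ hai] at h
    linarith
  have hright : ∑ m ∈ Finset.Ico i b, ν m < ∑ m ∈ Finset.Ico i b, μ m := by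
    unfold psum at hb h
    rw [← Finset.sum_range_add_sum_Ico _ hib, ← Finset.sum_range_add_sum_Ico _ hib] at hb
    linarith
  obtain ⟨m, hm, hlt⟩ := Finset.exists_lt_of_sum_lt hleft
  obtain ⟨m', hm', hlt'⟩ := Finset.exists_lt_of_sum_lt hright
  rw [Finset.mem_Ico] at hm hm'
  have h1 := hμ m m' (by omega) hm'.2
  have h2 := hν m m' hm.1 (by omega) (by omega) hm'.2
  omega

/-- Abel's inequality for a weakly decreasing weight and nonnegative partial sums. -/
theorem mul_psum_le_sum_mul (b d : ℕ → ℝ) (n : ℕ) (hb : ∀ i < n, b (i + 1) ≤ b i)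
    (hd : ∀ i ≤ n, 0 ≤ psum d i) :
    b n * psum d (n + 1) ≤ ∑ i ∈ Finset.range (n + 1), b i * d i := by
  induction n with
  | zero => simp [psum]
  | succ n ih =>
    have h1 := ih (fun i hi => hb i (by omega)) (fun i hi => hd i (by omega))
    have h2 := mul_le_mul_of_nonneg_right (hb n (Nat.lt_succ_self n)) (hd (n + 1) le_rfl)
    have h3 : psum d (n + 1 + 1) = psum d (n + 1) + d (n + 1) := Finset.sum_range_succ _ _
    rw [Finset.sum_range_succ, h3, mul_add]
    linarith

/-- A weakly decreasing weight pairs with a majorized sequence to a smaller value. -/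
theorem sum_mul_le_sum_mul_of_psum_le {n : ℕ} {a : Fin n → ℝ} (ha : Antitone a) {x y : ℕ → ℝ}
    (hle : ∀ i < n, psum x i ≤ psum y i) (heq : psum x n = psum y n) :
    ∑ i : Fin n, a i * x i ≤ ∑ i : Fin n, a i * y i := by
  obtain _ | n := n
  · simp
  let b : ℕ → ℝ := fun i => if h : i < n + 1 then a ⟨i, h⟩ else 0
  have hba (i : Fin (n + 1)) : b i = a i := dif_pos i.isLt
  have hsub (i : ℕ) : psum (fun m => y m - x m) i = psum y i - psum x i :=
    Finset.sum_sub_distrib _ _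
  have key := mul_psum_le_sum_mul b (fun m => y m - x m) n
    (fun i hi => by
      have h1 : i < n + 1 := by omega
      have h2 : i + 1 < n + 1 := by omega
      simp only [b, h1, h2, dif_pos]
      exact ha (by simp))
    (fun i hi => by
      have := hle i (by omega)
      rw [hsub]
      linarith)
  rw [hsub, heq, sub_self, mul_zero, ← Fin.sum_univ_eq_sum_range] at key
  simp only [hba, mul_sub, Finset.sum_sub_distrib] at key
  linarith

/-- Rado's theorem for sorted vectors: a weakly decreasing vector majorized by `y` lies in the
convex hull of the permutations of `y`. -/
theorem mem_convexHull_perm_of_psum_le {n : ℕ} {x y : ℕ → ℝ}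
    (hx : Antitone fun i : Fin n => x i)
    (hle : ∀ i < n, psum x i ≤ psum y i) (heq : psum x n = psum y n) :
    (fun i : Fin n => x i) ∈ convexHull ℝ {z : Fin n → ℝ |
      ∃ π : Equiv.Perm (Fin n), ∀ i, z i = y (π i)} := by
  set s : Set (Fin n → ℝ) := {z | ∃ π : Equiv.Perm (Fin n), ∀ i, z i = y (π i)}
  have hfin : s.Finite :=
    (Set.finite_range fun π : Equiv.Perm (Fin n) => fun i => y (π i)).subset
      fun z ⟨π, hπ⟩ => ⟨π, (funext hπ).symm⟩
  by_contra hmem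
  obtain ⟨f, u, hfu, huf⟩ :=
    geometric_hahn_banach_closed_point (convex_convexHull ℝ s) (hfin.isClosed_convexHull ℝ) hmem
  let a : Fin n → ℝ := fun i => f (Pi.single i 1)
  have hf (z : Fin n → ℝ) : f z = ∑ i, a i * z i := by
    conv_lhs => rw [pi_eq_sum_univ' z]
    rw [map_sum]
    refine Finset.sum_congr rfl fun i _ => ?_
    rw [map_smul, smul_eq_mul, mul_comm]
  let τ : Equiv.Perm (Fin n) := Tuple.sort fun i => -a i
  have hτ : Antitone (a ∘ τ) := fun i j hij => by
    have := Tuple.monotone_sort (fun i => -a i) hij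
    simp only [Function.comp_apply] at this
    exact neg_le_neg_iff.1 this
  have h1 : f (fun i => x i) ≤ ∑ i, (a ∘ τ) i * x i := by
    have := (hτ.monovary hx).sum_comp_perm_mul_le_sum_mul (σ := τ⁻¹)
    rw [hf]
    simpa using this
  have h2 := sum_mul_le_sum_mul_of_psum_le hτ hle heq
  have h3 : ∑ i, (a ∘ τ) i * y i = f (fun i => y (τ⁻¹ i : Fin n)) := by
    rw [hf, ← Equiv.sum_comp τ fun i => a i * y (τ⁻¹ i : Fin n)]
    simp
  have h4 := hfu _ (subset_convexHull ℝ s ⟨τ⁻¹, fun i => rfl⟩)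
  linarith

theorem stmt3 (n r : ℕ) (hr : 0 < r) (c : ℕ → ℕ)
    (hpos : ∀ k < r, 0 < c k) (hsum : sig c r = n)
    (μ ν : ℕ → ℤ)
    -- μ is GL_n-dominant
    (hμ : ∀ i i', i ≤ i' → i' < n → μ i' ≤ μ i)
    -- ν is GL_n-dominant
    (hν : ∀ i i', i ≤ i' → i' < n → ν i' ≤ ν i)
    -- ν is M-minuscule: entries of ν in the same batch differ by at most 1
    (hmin : ∀ i i', i < n → i' < n → batchIdx c r i = batchIdx c r i' →
      |ν i - ν i'| ≤ 1)
    -- S_i(ν_M) ≤ S_i(μ) for 1 ≤ i < n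
    (hle : ∀ i, 1 ≤ i → i < n →
      psum (avgVec c r n ν) i ≤ psum (fun m => (μ m : ℚ)) i)
    -- S_n(ν) = S_n(μ)
    (heq : psum ν n = psum μ n) :
    (∀ i, 1 ≤ i → i < n → psum ν i ≤ psum μ i) ∧
    (fun i : Fin n => (ν i : ℝ)) ∈
      convexHull ℝ {x : Fin n → ℝ |
        ∃ π : Equiv.Perm (Fin n), ∀ i, x i = (μ (π i) : ℝ)} := by
  subst hsum
  have hbdry : ∀ k ≤ r, psum ν (sig c k) ≤ psum μ (sig c k) := by
    intro k hk
    rcases (sig_mono c hk).lt_or_eq with hlt | h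
    · rcases Nat.eq_zero_or_pos (sig c k) with h0 | h0
      · simp [h0, psum]
      · have := hle _ h0 hlt
        rw [psum_avgVec_sig hpos ν hk] at this
        have hcast : psum (fun m => (μ m : ℚ)) (sig c k) = ((psum μ (sig c k) : ℤ) : ℚ) := by
          simp [psum]
        rw [hcast] at this
        exact_mod_cast this
    · rw [h, heq]
  have hmain : ∀ i < sig c r, psum ν i ≤ psum μ i := by
    intro i hi
    obtain ⟨k, hk, hki, hik⟩ := exists_batch hi
    have hn : sig c (k + 1) ≤ sig c r := sig_mono c hk
    refine psum_le_psum_of_endpoints hki hik.le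
      (fun m m' h h' => hμ m m' h (h'.trans_le hn)) (fun m m' h1 h2 h3 h4 => ?_)
      (hbdry k hk.le) (hbdry (k + 1) hk)
    have hm := h2.trans_le hn
    have hm' := h4.trans_le hn
    refine (le_abs_self _).trans (hmin m m' hm hm' ?_)
    rw [(batchIdx_eq_iff hk).2 ⟨h1, h2⟩, (batchIdx_eq_iff hk).2 ⟨h3, h4⟩]
  refine ⟨fun i _ hi => hmain i hi, ?_⟩
  have hcast (x : ℕ → ℤ) (i : ℕ) : psum (fun m => (x m : ℝ)) i = ((psum x i : ℤ) : ℝ) := by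
    simp [psum]
  refine mem_convexHull_perm_of_psum_le (x := fun m => (ν m : ℝ)) (y := fun m => (μ m : ℝ))
    (fun i j hij => ?_) (fun i hi => ?_) ?_
  · exact Int.cast_le.2 (hν i j hij j.2)
  · rw [hcast, hcast]
    exact_mod_cast hmain i hi
  · rw [hcast, hcast, heq]
end

section
/- Let μ ∈ ℤ^n be GL_n-dominant and let ν ∈ ℤ^n be M-dominant and M-minuscule with respect to (n_1,…,n_r). Suppose the batch-average vector ν_M is GL_n-dominant, S_i(ν_M) ≤ S_i(μ) for all 1 ≤ i < n, and S_n(ν) = S_n(μ). Then ν lies in the convex hull, in ℝ^n, of the set of all vectors obtained from μ by permuting its coordinates. -/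
open Finset

/-- Abel summation: if `w` is nonincreasing and `d` has nonnegative partial sums, then `∑ w i * d i`
is at least the last weight times the sum of `d`. -/
theorem last_mul_sum_le_sum_mul {n : ℕ} {w d : ℕ → ℝ}
    (hw : ∀ i, i + 1 < n → w (i + 1) ≤ w i)
    (hd : ∀ k ≤ n, 0 ≤ ∑ i ∈ range k, d i) {m : ℕ} (hm : m < n) :
    w m * ∑ i ∈ range (m + 1), d i ≤ ∑ i ∈ range (m + 1), w i * d i := by
  induction m with
  | zero => simp
  | succ m ih =>
    rw [sum_range_succ, sum_range_succ _ (m + 1)]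
    have h := mul_le_mul_of_nonneg_right (hw m hm) (hd (m + 1) hm.le)
    linarith [ih (by omega)]

theorem sum_mul_nonneg_of_partial_sums_nonneg {n : ℕ} {w d : ℕ → ℝ}
    (hw : ∀ i, i + 1 < n → w (i + 1) ≤ w i)
    (hd : ∀ k ≤ n, 0 ≤ ∑ i ∈ range k, d i) (h0 : ∑ i ∈ range n, d i = 0) :
    0 ≤ ∑ i ∈ range n, w i * d i := by
  cases n with
  | zero => simp
  | succ n => simpa [h0] using last_mul_sum_le_sum_mul hw hd n.lt_succ_self

/-- If `y` is nonincreasing and `∑ (x i - t)⁺ ≤ ∑ (y i - t)⁺` for every value `t` of `y`, then the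
partial sums of `x` are bounded by those of `y`. -/
theorem sum_range_le_of_sum_max_le {n : ℕ} {x y : ℕ → ℝ}
    (hy : ∀ i j, i ≤ j → j < n → y j ≤ y i)
    (hxy : ∀ j < n, ∑ i ∈ range n, max (x i - y j) 0 ≤ ∑ i ∈ range n, max (y i - y j) 0)
    {k : ℕ} (hk : k ≤ n) : ∑ i ∈ range k, x i ≤ ∑ i ∈ range k, y i := by
  rcases k with _ | k
  · simp
  have hx : ∑ i ∈ range (k + 1), (x i - y k) ≤ ∑ i ∈ range n, max (x i - y k) 0 :=
    (sum_le_sum fun i _ => le_max_left _ _).trans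
      (sum_le_sum_of_subset_of_nonneg (range_subset_range.2 hk) fun i _ _ => le_max_right _ _)
  have hy' : ∑ i ∈ range n, max (y i - y k) 0 = ∑ i ∈ range (k + 1), (y i - y k) := by
    rw [← sum_subset (range_subset_range.2 hk)]
    · refine sum_congr rfl fun i hi => max_eq_left (sub_nonneg.2 (hy i k ?_ hk))
      exact Nat.lt_succ_iff.1 (mem_range.1 hi)
    · intro i hi hi'
      simp only [mem_range, not_lt] at hi hi'
      exact max_eq_right (sub_nonpos.2 (hy k i (by omega) hi))
  have h := hx.trans ((hxy k hk).trans_eq hy')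
  simpa only [sum_sub_distrib, sub_le_sub_iff_right] using h

/-- A form of Rado's theorem: a vector majorized by a nonincreasing vector `y` is in the convex hull
of the permutations of `y`. -/
theorem mem_convexHull_perm_of_sum_max_le {n : ℕ} {x y : Fin n → ℝ} (hy : Antitone y)
    (hxy : ∀ j, ∑ i, max (x i - y j) 0 ≤ ∑ i, max (y i - y j) 0)
    (hsum : ∑ i, x i = ∑ i, y i) :
    x ∈ convexHull ℝ {z : Fin n → ℝ | ∃ π : Equiv.Perm (Fin n), ∀ i, z i = y (π i)} := by
  set P := {z : Fin n → ℝ | ∃ π : Equiv.Perm (Fin n), ∀ i, z i = y (π i)}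
  have hP : P.Finite := by
    refine (Set.finite_range fun π : Equiv.Perm (Fin n) => y ∘ π).subset ?_
    rintro z ⟨π, hπ⟩
    exact ⟨π, funext fun i => (hπ i).symm⟩
  by_contra hx
  obtain ⟨f, u, hfu, hux⟩ := geometric_hahn_banach_closed_point (convex_convexHull ℝ P)
    (hP.isClosed_convexHull ℝ) hx
  let w : Fin n → ℝ := fun i => f (Pi.single i 1)
  have hf : ∀ z, f z = ∑ i, w i * z i := fun z => by
    conv_lhs => rw [← Finset.univ_sum_single z]
    rw [map_sum]
    refine sum_congr rfl fun i _ => ?_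
    have : (Pi.single i (z i) : Fin n → ℝ) = z i • Pi.single i 1 := by
      rw [← Pi.single_smul, smul_eq_mul, mul_one]
    rw [this, map_smul, smul_eq_mul, mul_comm]
  let σ : Equiv.Perm (Fin n) := Tuple.sort (fun i => -w i)
  have hσ : Antitone (w ∘ σ) := fun i j hij => by
    simpa using Tuple.monotone_sort (fun i => -w i) hij
  let ext : (Fin n → ℝ) → ℕ → ℝ := fun z i => if h : i < n then z ⟨i, h⟩ else 0
  have hext : ∀ z (i : Fin n), ext z i = z i := fun z i => by simp [ext]
  have hlt : ∀ z i (h : i < n), ext z i = z ⟨i, h⟩ := fun z i h => by simp [ext, h]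
  have hpart : ∀ k ≤ n, ∑ i ∈ range k, ext (x ∘ σ) i ≤ ∑ i ∈ range k, ext y i := by
    intro k hk
    refine sum_range_le_of_sum_max_le ?_ ?_ hk
    · intro i j hij hj
      rw [hlt _ _ hj, hlt _ _ (hij.trans_lt hj)]
      exact hy hij
    · intro j hj
      rw [← Fin.sum_univ_eq_sum_range (fun i => max (ext (x ∘ σ) i - ext y j) 0),
        ← Fin.sum_univ_eq_sum_range (fun i => max (ext y i - ext y j) 0)]
      simp only [hext, hlt _ _ hj, Function.comp_apply]
      rw [Equiv.sum_comp σ (fun i => max (x i - y ⟨j, hj⟩) 0)]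
      exact hxy _
  have hmain := sum_mul_nonneg_of_partial_sums_nonneg (n := n) (w := ext (w ∘ σ))
    (d := fun i => ext y i - ext (x ∘ σ) i)
    (fun i hi => by
      rw [hlt _ _ hi, hlt _ _ (i.lt_succ_self.trans hi)]
      exact hσ (Fin.mk_le_mk.2 i.le_succ))
    (fun k hk => by
      rw [sum_sub_distrib]
      exact sub_nonneg.2 (hpart k hk))
    (by
      rw [← Fin.sum_univ_eq_sum_range (fun i => ext y i - ext (x ∘ σ) i)]
      simp only [hext, sum_sub_distrib, Function.comp_apply]
      rw [Equiv.sum_comp σ x, hsum, sub_self])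
  rw [← Fin.sum_univ_eq_sum_range
    (fun i => ext (w ∘ σ) i * (ext y i - ext (x ∘ σ) i))] at hmain
  simp only [hext, Function.comp_apply, mul_sub, sum_sub_distrib] at hmain
  rw [Equiv.sum_comp σ (fun i => w i * x i), ← hf] at hmain
  have hperm := hfu (y ∘ σ.symm) (subset_convexHull ℝ P ⟨σ.symm, fun i => rfl⟩)
  rw [hf, ← Equiv.sum_comp σ] at hperm
  simp only [Function.comp_apply, Equiv.symm_apply_apply] at hperm
  linarith

/-- Replacing entries by their average over a fibre of `b` does not change sums over a fibre. -/
theorem sum_filter_average_eq {ι κ : Type*} [DecidableEq κ] (s : Finset ι) (b : ι → κ)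
    (f : ι → ℚ) (j : κ) :
    ∑ i ∈ s with b i = j, (∑ m ∈ s, if b m = b i then f m else 0) /
        (∑ m ∈ s, if b m = b i then (1 : ℚ) else 0) = ∑ i ∈ s with b i = j, f i := by
  have h : ∀ i ∈ s.filter (b · = j), (∑ m ∈ s, if b m = b i then f m else 0) /
        (∑ m ∈ s, if b m = b i then (1 : ℚ) else 0) =
      (∑ m ∈ s with b m = j, f m) / #(s.filter (b · = j)) := by
    intro i hi
    rw [(mem_filter.1 hi).2, ← sum_filter, ← sum_filter, sum_const, nsmul_one]
  rw [sum_congr rfl h, sum_const, nsmul_eq_mul]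
  rcases (s.filter (b · = j)).eq_empty_or_nonempty with h0 | h0
  · simp [h0]
  · exact mul_div_cancel₀ _ (Nat.cast_ne_zero.2 h0.card_pos.ne')

theorem sum_filter_avgVec {c : ℕ → ℕ} {r n : ℕ} (hsum : sig c r = n) (ν : ℕ → ℤ) (j : ℕ) :
    ∑ i ∈ range n with batchIdx c r i = j, avgVec c r n ν i =
      ∑ i ∈ range n with batchIdx c r i = j, (ν i : ℚ) := by
  rw [← sum_filter_average_eq (range n) (batchIdx c r) (fun i => (ν i : ℚ)) j]
  refine sum_congr rfl fun i hi => if_neg ?_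
  rw [hsum, not_le]
  exact mem_range.1 (mem_filter.1 hi).1

theorem psum_avgVec {c : ℕ → ℕ} {r n : ℕ} (hsum : sig c r = n) (ν : ℕ → ℤ) :
    psum (avgVec c r n ν) n = ∑ i ∈ range n, (ν i : ℚ) := by
  have hmaps : ∀ i ∈ range n, batchIdx c r i ∈ (range n).image (batchIdx c r) :=
    fun i hi => mem_image_of_mem _ hi
  rw [psum, ← sum_fiberwise_of_maps_to hmaps, ← sum_fiberwise_of_maps_to hmaps]
  exact sum_congr rfl fun j _ => sum_filter_avgVec hsum ν j

/-- In a minuscule batch the entries lie all above or all below an integer `t`, so averaging can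
only increase `∑ (ν i - t)⁺` (in fact it preserves it). -/
theorem sum_max_le_sum_max_avgVec {c : ℕ → ℕ} {r n : ℕ} (hsum : sig c r = n) {ν : ℕ → ℤ}
    (hM : ∀ i i', i ≤ i' → i' < n → batchIdx c r i = batchIdx c r i' →
      ν i' ≤ ν i ∧ ν i ≤ ν i' + 1) (t : ℤ) :
    ∑ i ∈ range n, max ((ν i : ℚ) - t) 0 ≤ ∑ i ∈ range n, max (avgVec c r n ν i - t) 0 := by
  have hmaps : ∀ i ∈ range n, batchIdx c r i ∈ (range n).image (batchIdx c r) :=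
    fun i hi => mem_image_of_mem _ hi
  rw [← sum_fiberwise_of_maps_to hmaps, ← sum_fiberwise_of_maps_to hmaps]
  refine sum_le_sum fun j _ => ?_
  by_cases h : ∀ i ∈ (range n).filter (batchIdx c r · = j), t ≤ ν i
  · calc
      _ = ∑ i ∈ range n with batchIdx c r i = j, ((ν i : ℚ) - t) :=
        sum_congr rfl fun i hi => max_eq_left (sub_nonneg.2 (Int.cast_le.2 (h i hi)))
      _ = ∑ i ∈ range n with batchIdx c r i = j, (avgVec c r n ν i - t) := by
        rw [sum_sub_distrib, sum_sub_distrib, sum_filter_avgVec hsum]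
      _ ≤ _ := sum_le_sum fun i _ => le_max_left _ _
  · push Not at h
    obtain ⟨m, hm, hmt⟩ := h
    refine sum_le_sum fun i hi => ?_
    rw [mem_filter, mem_range] at hm hi
    have hit : ν i ≤ t := by
      rcases le_total i m with him | him
      · have := hM i m him hm.1 (hi.2.trans hm.2.symm)
        omega
      · have := hM m i him hi.1 (hm.2.trans hi.2.symm)
        omega
    rw [max_eq_right (sub_nonpos.2 (Int.cast_le.2 hit))]
    exact le_max_right _ _

/-- For a nonincreasing sequence `a` whose partial sums are bounded by those of `b`, one has
`∑ (a i - t)⁺ ≤ ∑ (b i - t)⁺`. -/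
theorem sum_max_le_sum_max_of_psum_le {n : ℕ} {a b : ℕ → ℚ}
    (ha : ∀ i j, i ≤ j → j < n → a j ≤ a i) (hab : ∀ k ≤ n, psum a k ≤ psum b k) (t : ℚ) :
    ∑ i ∈ range n, max (a i - t) 0 ≤ ∑ i ∈ range n, max (b i - t) 0 := by
  obtain ⟨k, hkn, hlo, hhi⟩ : ∃ k ≤ n, (∀ i < k, t ≤ a i) ∧ ∀ i, k ≤ i → i < n → a i ≤ t := by
    have hex : ∃ k, n ≤ k ∨ a k < t := ⟨n, Or.inl le_rfl⟩
    classical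
    refine ⟨Nat.find hex, Nat.find_min' hex (Or.inl le_rfl), fun i hi => ?_, fun i hi hin => ?_⟩
    · exact not_lt.1 fun h => Nat.find_min hex hi (Or.inr h)
    · rcases Nat.find_spec hex with h | h
      · omega
      · exact (ha _ i hi hin).trans h.le
  calc
    _ = ∑ i ∈ range k, (a i - t) := by
      rw [← sum_subset (range_subset_range.2 hkn)]
      · exact sum_congr rfl fun i hi => max_eq_left (sub_nonneg.2 (hlo i (mem_range.1 hi)))
      · intro i hi hi'
        simp only [mem_range, not_lt] at hi hi'
        exact max_eq_right (sub_nonpos.2 (hhi i hi' hi))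
    _ ≤ ∑ i ∈ range k, (b i - t) := by
      simpa only [psum, sum_sub_distrib, sub_le_sub_iff_right] using hab k hkn
    _ ≤ ∑ i ∈ range k, max (b i - t) 0 := sum_le_sum fun i _ => le_max_left _ _
    _ ≤ _ := sum_le_sum_of_subset_of_nonneg (range_subset_range.2 hkn)
      fun i _ _ => le_max_right _ _

theorem stmt4 (n r : ℕ) (hr : 0 < r) (c : ℕ → ℕ)
    (hpos : ∀ k < r, 0 < c k) (hsum : sig c r = n)
    (μ ν : ℕ → ℤ)
    -- μ is GL_n-dominant
    (hμ : ∀ i i', i ≤ i' → i' < n → μ i' ≤ μ i)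
    -- ν is M-dominant and M-minuscule
    (hM : ∀ i i', i ≤ i' → i' < n → batchIdx c r i = batchIdx c r i' →
      ν i' ≤ ν i ∧ ν i ≤ ν i' + 1)
    -- ν_M is GL_n-dominant
    (hdom : ∀ i i', i ≤ i' → i' < n → avgVec c r n ν i' ≤ avgVec c r n ν i)
    -- S_i(ν_M) ≤ S_i(μ) for 1 ≤ i < n
    (hle : ∀ i, 1 ≤ i → i < n →
      psum (avgVec c r n ν) i ≤ psum (fun m => (μ m : ℚ)) i)
    -- S_n(ν) = S_n(μ)
    (heq : psum ν n = psum μ n) :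
    (fun i : Fin n => (ν i : ℝ)) ∈
      convexHull ℝ {x : Fin n → ℝ |
        ∃ π : Equiv.Perm (Fin n), ∀ i, x i = (μ (π i) : ℝ)} := by
  have hpsum : ∀ k ≤ n, psum (avgVec c r n ν) k ≤ psum (fun m => (μ m : ℚ)) k := by
    intro k hk
    rcases k.eq_zero_or_pos with rfl | hk0
    · simp [psum]
    rcases hk.lt_or_eq with hkn | rfl
    · exact hle k hk0 hkn
    · rw [psum_avgVec hsum]
      simp only [psum] at heq ⊢
      exact_mod_cast heq.le
  have hmax : ∀ t : ℤ, ∑ i ∈ range n, max (ν i - t) 0 ≤ ∑ i ∈ range n, max (μ i - t) 0 := by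
    intro t
    exact_mod_cast (sum_max_le_sum_max_avgVec hsum hM t).trans
      (sum_max_le_sum_max_of_psum_le hdom hpsum t)
  refine mem_convexHull_perm_of_sum_max_le (y := fun i : Fin n => (μ i : ℝ)) ?_ ?_ ?_
  · exact fun i j hij => Int.cast_le.2 (hμ i j hij j.2)
  · intro j
    rw [Fin.sum_univ_eq_sum_range (fun i => max ((ν i : ℝ) - μ j) 0),
      Fin.sum_univ_eq_sum_range (fun i => max ((μ i : ℝ) - μ j) 0)]
    exact_mod_cast hmax (μ j)
  · rw [Fin.sum_univ_eq_sum_range (fun i => (ν i : ℝ)),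
      Fin.sum_univ_eq_sum_range (fun i => (μ i : ℝ))]
    unfold psum at heq
    exact_mod_cast heq
end

section
/- Let μ ∈ ℤ^n be SO_{2n+1}-dominant and let ν ∈ ℤ^n be M-dominant and M-minuscule of type B with respect to (n_1,…,n_r; j). Suppose ν_M is SO_{2n+1}-dominant, S_i(ν_M) ≤ S_i(μ) for all 1 ≤ i ≤ n, and S_n(μ) − S_n(ν) is even. Then ν lies in the convex hull, in ℝ^n, of the set of all vectors obtained from μ by permuting its coordinates and changing the signs of an arbitrary subset of its coordinates. -/
open Finset

/-- Abel summation: weighting by a nonnegative nonincreasing sequence preserves nonnegativity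
of partial sums. -/
lemma sum_mul_nonneg_of_psum_nonneg (n : ℕ) (g d : ℕ → ℝ) (hg : Antitone g) (hg0 : ∀ i, 0 ≤ g i)
    (hd : ∀ k ≤ n, 0 ≤ psum d k) : 0 ≤ ∑ i ∈ range n, g i * d i := by
  have key : ∀ k ≤ n, g k * psum d k ≤ ∑ i ∈ range k, g i * d i := by
    intro k
    induction k with
    | zero => simp [psum]
    | succ k ih =>
      intro hk
      have h1 := ih (by omega)
      have h2 : g (k + 1) * psum d (k + 1) ≤ g k * psum d (k + 1) :=
        mul_le_mul_of_nonneg_right (hg (Nat.le_succ k)) (hd _ hk)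
      have h3 : psum d (k + 1) = psum d k + d k := sum_range_succ _ _
      rw [sum_range_succ]
      rw [h3] at h2 ⊢
      linarith [mul_add (g k) (psum d k) (d k)]
  exact (mul_nonneg (hg0 n) (hd n le_rfl)).trans (key n le_rfl)

/-- Every linear functional on `ℝⁿ` is bounded at a nonnegative vector `x`, weakly majorized by
`y`, by its value at some signed permutation of `y`. -/
lemma exists_signed_perm_dotProduct_le (n : ℕ) (x y : ℕ → ℝ) (hx : ∀ i < n, 0 ≤ x i)
    (hxy : ∀ s ⊆ range n, ∑ i ∈ s, x i ≤ psum y #s) (f : Fin n → ℝ) :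
    ∃ (π : Equiv.Perm (Fin n)) (ε : Fin n → ℝ), (∀ i, ε i = 1 ∨ ε i = -1) ∧
      ∑ i, f i * x i ≤ ∑ i, f i * (ε i * y (π i)) := by
  let τ : Equiv.Perm (Fin n) := Tuple.sort (fun i => -|f i|)
  have hτ : Monotone ((fun i => -|f i|) ∘ τ) := Tuple.monotone_sort _
  refine ⟨τ.symm, fun i => if 0 ≤ f i then 1 else -1, fun i => by
    by_cases h : 0 ≤ f i <;> simp [h], ?_⟩
  have h1 : ∑ i, f i * x i ≤ ∑ i, |f i| * x i :=
    sum_le_sum fun i _ => mul_le_mul_of_nonneg_right (le_abs_self _) (hx i i.2)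
  have h2 : ∑ i, f i * ((if 0 ≤ f i then 1 else -1) * y (τ.symm i)) =
      ∑ i, |f i| * y (τ.symm i) := by
    refine sum_congr rfl fun i _ => ?_
    split_ifs with h
    · rw [abs_of_nonneg h]; ring
    · rw [abs_of_neg (not_le.mp h)]; ring
  rw [h2]
  refine h1.trans ?_
  rw [← Equiv.sum_comp τ fun i => |f i| * x i, ← Equiv.sum_comp τ fun i => |f i| * y (τ.symm i)]
  simp only [Equiv.symm_apply_apply]
  let g : ℕ → ℝ := fun i => if h : i < n then |f (τ ⟨i, h⟩)| else 0
  let d : ℕ → ℝ := fun i => if h : i < n then y i - x (τ ⟨i, h⟩) else 0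
  have hg0 : ∀ i, 0 ≤ g i := fun i => by
    simp only [g]; split_ifs <;> simp
  have hg : Antitone g := by
    intro a b hab
    by_cases hb : b < n
    · have := hτ (show (⟨a, hab.trans_lt hb⟩ : Fin n) ≤ ⟨b, hb⟩ from hab)
      simpa [g, hb, hab.trans_lt hb] using this
    · simpa [g, hb] using hg0 a
  have hd : ∀ k ≤ n, 0 ≤ psum d k := by
    intro k hk
    let e : Fin k → ℕ := fun i => (τ (Fin.castLE hk i) : ℕ)
    have he : Function.Injective e := fun a b hab => by
      simpa [e, Fin.val_inj] using hab
    have h := hxy (univ.image e) (by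
      intro i hi
      obtain ⟨a, -, rfl⟩ := mem_image.mp hi
      exact mem_range.mpr (τ _).2)
    rw [sum_image he.injOn, card_image_of_injective _ he, card_univ, Fintype.card_fin] at h
    have h' : psum d k = psum y k - ∑ i, x (e i) := by
      simp only [psum, ← Fin.sum_univ_eq_sum_range, ← sum_sub_distrib]
      refine sum_congr rfl fun i _ => ?_
      simp only [d, dif_pos (i.2.trans_le hk)]
      rfl
    rw [h']; linarith
  have h := sum_mul_nonneg_of_psum_nonneg n g d hg hg0 hd
  rw [← Fin.sum_univ_eq_sum_range (fun i => g i * d i)] at h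
  simp only [g, d, Fin.is_lt, dif_pos, Fin.eta, mul_sub, sum_sub_distrib] at h
  linarith

/-- A nonnegative vector weakly majorized by `y` is in the convex hull of the signed
permutations of `y`. -/
lemma mem_convexHull_signed_perm (n : ℕ) (x y : ℕ → ℝ) (hx : ∀ i < n, 0 ≤ x i)
    (hxy : ∀ s ⊆ range n, ∑ i ∈ s, x i ≤ psum y #s) :
    (fun i : Fin n => x i) ∈ convexHull ℝ {z : Fin n → ℝ |
        ∃ (π : Equiv.Perm (Fin n)) (ε : Fin n → ℝ),
          (∀ i, ε i = 1 ∨ ε i = -1) ∧ ∀ i, z i = ε i * y (π i)} := by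
  set V : Set (Fin n → ℝ) := {z | ∃ (π : Equiv.Perm (Fin n)) (ε : Fin n → ℝ),
          (∀ i, ε i = 1 ∨ ε i = -1) ∧ ∀ i, z i = ε i * y (π i)}
  have hfin : V.Finite := by
    have hE : {ε : Fin n → ℝ | ∀ i, ε i = 1 ∨ ε i = -1}.Finite :=
      (Set.Finite.pi' fun _ : Fin n => Set.toFinite ({1, -1} : Set ℝ)).subset fun ε hε i => by
        simpa using hε i
    refine ((Set.finite_univ (α := Equiv.Perm (Fin n))).image2
      (fun π ε i => ε i * y (π i)) hE).subset ?_
    rintro z ⟨π, ε, hε, hz⟩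
    exact ⟨π, trivial, ε, hε, (funext hz).symm⟩
  by_contra hnot
  obtain ⟨F, u, hFu, hu⟩ := geometric_hahn_banach_closed_point (convex_convexHull ℝ V)
    (hfin.isCompact_convexHull ℝ).isClosed hnot
  have hF : ∀ z : Fin n → ℝ, F z = ∑ i, F (Pi.single i 1) * z i := by
    intro z
    conv_lhs => rw [← univ_sum_single z, map_sum]
    refine sum_congr rfl fun i _ => ?_
    rw [show Pi.single i (z i) = z i • Pi.single i (1 : ℝ) by simp [← Pi.single_smul],
      map_smul, smul_eq_mul, mul_comm]
  obtain ⟨π, ε, hε, h⟩ := exists_signed_perm_dotProduct_le n x y hx hxy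
    fun i => F (Pi.single i 1)
  have h1 := hFu _ (subset_convexHull ℝ V ⟨π, ε, hε, fun _ => rfl⟩)
  rw [hF] at h1 hu
  linarith

/-- Majorization from hinge functions at integer thresholds. -/
lemma sum_le_psum_of_hinge (n : ℕ) (μ ν : ℕ → ℤ)
    (hμ : ∀ i i', i ≤ i' → i' < n → μ i' ≤ μ i) (hμ0 : ∀ i < n, 0 ≤ μ i)
    (h : ∀ m : ℤ, 0 ≤ m → ∑ i ∈ range n, max (ν i - m) 0 ≤ ∑ i ∈ range n, max (μ i - m) 0)
    (s : Finset ℕ) (hs : s ⊆ range n) : ∑ i ∈ s, ν i ≤ psum μ #s := by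
  have hcard : #s ≤ n := by simpa using card_le_card hs
  obtain ⟨m, hm0, hlo, hhi⟩ : ∃ m : ℤ, 0 ≤ m ∧ (∀ i < #s, m ≤ μ i) ∧
      ∀ i < n, #s ≤ i → μ i ≤ m := by
    rcases hcard.lt_or_eq with hlt | heq
    · exact ⟨μ #s, hμ0 _ hlt, fun i hi => hμ _ _ hi.le hlt, fun i hi hk => hμ _ _ hk hi⟩
    · exact ⟨0, le_rfl, fun i hi => hμ0 i (by omega), fun i hi hk => by omega⟩
  have h1 : ∑ i ∈ s, (ν i - m) ≤ ∑ i ∈ range n, max (ν i - m) 0 :=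
    (sum_le_sum fun i _ => le_max_left _ _).trans
      (sum_le_sum_of_subset_of_nonneg hs fun i _ _ => le_max_right _ _)
  have h2 : ∑ i ∈ range n, max (μ i - m) 0 = ∑ i ∈ range #s, (μ i - m) := by
    rw [← sum_subset (range_mono hcard)]
    · exact sum_congr rfl fun i hi => max_eq_left (by linarith [hlo i (mem_range.mp hi)])
    · intro i hi hi'
      exact max_eq_right (by linarith [hhi i (mem_range.mp hi) (by simpa using hi')])
  have h3 := h m hm0
  rw [h2] at h3
  have h4 := h1.trans h3
  simp only [sum_sub_distrib, sum_const, card_range] at h4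
  simpa [psum] using h4

/-- Replacing a vector by its averages over the fibres of `b` does not change its pairing with
a vector constant on these fibres. -/
lemma sum_mul_fibre_average (n : ℕ) (b : ℕ → ℕ) (v g : ℕ → ℚ)
    (hg : ∀ i < n, ∀ m < n, b m = b i → g m = g i) :
    ∑ i ∈ range n, g i * ((∑ m ∈ range n, if b m = b i then v m else 0) /
      (∑ m ∈ range n, if b m = b i then (1 : ℚ) else 0)) = ∑ i ∈ range n, g i * v i := by
  set N : ℕ → ℚ := fun i => ∑ m ∈ range n, if b m = b i then (1 : ℚ) else 0 with hN
  have hN0 : ∀ i ∈ range n, 0 < N i := fun i hi =>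
    sum_pos' (fun m _ => by split_ifs <;> norm_num) ⟨i, hi, by simp⟩
  calc ∑ i ∈ range n, g i * ((∑ m ∈ range n, if b m = b i then v m else 0) / N i)
      = ∑ i ∈ range n, ∑ m ∈ range n, if b m = b i then g i * v m / N i else 0 := by
        refine sum_congr rfl fun i _ => ?_
        rw [sum_div, mul_sum]
        refine sum_congr rfl fun m _ => ?_
        split_ifs <;> ring
    _ = ∑ m ∈ range n, ∑ i ∈ range n, if b m = b i then g i * v m / N i else 0 := sum_comm
    _ = ∑ m ∈ range n, g m * v m := by
        refine sum_congr rfl fun m hm => ?_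
        have : ∀ i ∈ range n, (if b m = b i then g i * v m / N i else 0) =
            g m * v m / N m * if b i = b m then 1 else 0 := by
          intro i hi
          by_cases h : b m = b i
          · have hNN : N i = N m := by simp only [hN, h]
            rw [if_pos h, if_pos h.symm, hNN,
              hg i (mem_range.mp hi) m (mem_range.mp hm) h, mul_one]
          · rw [if_neg h, if_neg (Ne.symm h), mul_zero]
        rw [sum_congr rfl this, ← mul_sum]
        exact div_mul_cancel₀ _ (hN0 m hm).ne'

lemma sig_le_iff_batchIdx_eq (c : ℕ → ℕ) (r i : ℕ) : sig c r ≤ i ↔ batchIdx c r i = r := by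
  constructor
  · intro h
    exact le_antisymm (Nat.findGreatest_le r) (Nat.le_findGreatest le_rfl h)
  · intro h
    have : sig c (batchIdx c r i) ≤ i :=
      Nat.findGreatest_spec (P := fun k => sig c k ≤ i) (Nat.zero_le r) (by simp [sig])
    rwa [h] at this

lemma avgVec_congr (c : ℕ → ℕ) (r n : ℕ) (ν : ℕ → ℤ) {i i' : ℕ}
    (h : batchIdx c r i = batchIdx c r i') : avgVec c r n ν i = avgVec c r n ν i' := by
  simp only [avgVec, sig_le_iff_batchIdx_eq, h]

lemma sum_mul_avgVec (c : ℕ → ℕ) (r n : ℕ) (ν : ℕ → ℤ) (g : ℕ → ℚ)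
    (hg : ∀ i i', batchIdx c r i = batchIdx c r i' → g i = g i')
    (hg0 : ∀ i, sig c r ≤ i → g i = 0) :
    ∑ i ∈ range n, g i * avgVec c r n ν i = ∑ i ∈ range n, g i * (ν i : ℚ) := by
  rw [← sum_mul_fibre_average n (batchIdx c r) (fun i => (ν i : ℚ)) g
    fun i _ m _ h => hg m i h]
  refine sum_congr rfl fun i _ => ?_
  by_cases h : sig c r ≤ i
  · simp [hg0 i h]
  · simp [avgVec, h]

/-- Outside the final batch, the deviation `avgVec i - t` is the average of the `ν m - t`. -/
lemma exists_pos_mul_avgVec_sub (c : ℕ → ℕ) (r n : ℕ) (ν : ℕ → ℤ) {i : ℕ} (hi : i < n)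
    (hir : i < sig c r) : ∃ N : ℚ, 0 < N ∧ ∀ t : ℤ, N * (avgVec c r n ν i - t) =
      ∑ m ∈ range n, if batchIdx c r m = batchIdx c r i then ((ν m : ℚ) - t) else 0 := by
  have hN0 : 0 < ∑ m ∈ range n, if batchIdx c r m = batchIdx c r i then (1 : ℚ) else 0 :=
    sum_pos' (fun m _ => by split_ifs <;> norm_num) ⟨i, mem_range.mpr hi, by simp⟩
  refine ⟨_, hN0, fun t => ?_⟩
  rw [avgVec, if_neg (by omega), mul_sub, mul_div_cancel₀ _ hN0.ne', sum_mul,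
    ← sum_sub_distrib]
  refine sum_congr rfl fun m _ => ?_
  split_ifs <;> ring

section Minuscule

variable {n r : ℕ} {c : ℕ → ℕ} {ν : ℕ → ℤ}

lemma abs_sub_le_one_of_batchIdx_eq
    (hM : ∀ i i', i ≤ i' → i' < sig c r → batchIdx c r i = batchIdx c r i' →
      ν i' ≤ ν i ∧ ν i ≤ ν i' + 1) {i m : ℕ} (hir : i < sig c r)
    (h : batchIdx c r m = batchIdx c r i) : ν m ≤ ν i + 1 ∧ ν i ≤ ν m + 1 := by
  have hmr : m < sig c r := by
    rw [← not_le, sig_le_iff_batchIdx_eq] at hir ⊢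
    rwa [h]
  rcases le_total i m with him | him
  · have := hM i m him hmr h.symm; omega
  · have := hM m i him hir h; omega

lemma lt_avgVec_of_lt
    (hM : ∀ i i', i ≤ i' → i' < sig c r → batchIdx c r i = batchIdx c r i' →
      ν i' ≤ ν i ∧ ν i ≤ ν i' + 1) {i : ℕ} (hi : i < n) (hir : i < sig c r) {t : ℤ}
    (ht : t < ν i) : (t : ℚ) < avgVec c r n ν i := by
  obtain ⟨N, hN, h⟩ := exists_pos_mul_avgVec_sub c r n ν hi hir
  have : 0 < N * (avgVec c r n ν i - t) := by
    rw [h]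
    refine sum_pos' (fun m _ => ?_) ⟨i, mem_range.mpr hi, ?_⟩
    · split_ifs with hb
      · have := abs_sub_le_one_of_batchIdx_eq hM hir hb
        exact_mod_cast (by omega : 0 ≤ ν m - t)
      · exact le_rfl
    · rw [if_pos rfl]
      exact_mod_cast (by omega : 0 < ν i - t)
  linarith [(mul_pos_iff_of_pos_left hN).mp this]

lemma avgVec_lt_of_lt
    (hM : ∀ i i', i ≤ i' → i' < sig c r → batchIdx c r i = batchIdx c r i' →
      ν i' ≤ ν i ∧ ν i ≤ ν i' + 1) {i : ℕ} (hi : i < n) (hir : i < sig c r) {t : ℤ}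
    (ht : ν i < t) : avgVec c r n ν i < t := by
  obtain ⟨N, hN, h⟩ := exists_pos_mul_avgVec_sub c r n ν hi hir
  have : N * (avgVec c r n ν i - t) < 0 := by
    rw [h]
    refine sum_neg' (fun m _ => ?_) ⟨i, mem_range.mpr hi, ?_⟩
    · split_ifs with hb
      · have := abs_sub_le_one_of_batchIdx_eq hM hir hb
        exact_mod_cast (by omega : ν m - t ≤ 0)
      · exact le_rfl
    · rw [if_pos rfl]
      exact_mod_cast (by omega : ν i - t < 0)
  linarith [neg_of_mul_neg_right this hN.le]

/-- The hinge sum of `ν` at an integer threshold `m ≥ 1` is that of its batch averages. -/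
lemma sum_hinge_eq_sum_hinge_avgVec
    (hM : ∀ i i', i ≤ i' → i' < sig c r → batchIdx c r i = batchIdx c r i' →
      ν i' ≤ ν i ∧ ν i ≤ ν i' + 1)
    (hfin : ∀ i, sig c r ≤ i → i < n → ν i ≤ 1) {m : ℤ} (hm : 1 ≤ m) :
    ((∑ i ∈ range n, max (ν i - m) 0 : ℤ) : ℚ) =
      ∑ i ∈ range n, if (m : ℚ) < avgVec c r n ν i then avgVec c r n ν i - m else 0 := by
  have key := sum_mul_avgVec c r n ν (fun i => if (m : ℚ) < avgVec c r n ν i then 1 else 0)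
    (fun i i' h => by simp only [avgVec_congr c r n ν h])
    (fun i h => if_neg (by
      rw [avgVec, if_pos h, not_lt]
      exact_mod_cast (by omega : 0 ≤ m)))
  have h1 : ∀ i ∈ range n, ((max (ν i - m) 0 : ℤ) : ℚ) =
      (if (m : ℚ) < avgVec c r n ν i then 1 else 0) * (ν i : ℚ) -
        (if (m : ℚ) < avgVec c r n ν i then 1 else 0) * m := by
    intro i hi
    rw [mem_range] at hi
    split_ifs with h
    · have hir : i < sig c r := by
        by_contra hir
        rw [avgVec, if_pos (not_lt.mp hir)] at h
        have : m < 0 := by exact_mod_cast h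
        omega
      have : m ≤ ν i := by
        by_contra! hlt
        exact lt_asymm h (avgVec_lt_of_lt hM hi hir hlt)
      rw [max_eq_left (by omega)]
      push_cast; ring
    · have : ν i ≤ m := by
        by_contra! hlt
        rcases lt_or_ge i (sig c r) with hir | hir
        · exact h (lt_avgVec_of_lt hM hi hir hlt)
        · have := hfin i hir hi; omega
      rw [max_eq_right (by omega)]
      simp
  push_cast only [Int.cast_sum]
  rw [sum_congr rfl h1, sum_sub_distrib, ← key, ← sum_sub_distrib]
  refine sum_congr rfl fun i _ => ?_
  split_ifs <;> ring

/-- The final batch, lost by averaging, contributes at most `1` to the total of `ν`. -/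
lemma psum_le_psum_avgVec_add_one
    (hfin : (∀ i, sig c r ≤ i → i < n → ν i = 0) ∨
            (∀ i, sig c r ≤ i → i < n → ν i = if i = sig c r then 1 else 0)) :
    ((psum ν n : ℤ) : ℚ) ≤ psum (avgVec c r n ν) n + 1 := by
  have key := sum_mul_avgVec c r n ν (fun i => if sig c r ≤ i then 0 else 1)
    (fun i i' h => by simp only [sig_le_iff_batchIdx_eq, h]) (fun i h => if_pos h)
  have h1 : psum (avgVec c r n ν) n =
      ∑ i ∈ range n, (if sig c r ≤ i then 0 else 1) * avgVec c r n ν i := by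
    refine sum_congr rfl fun i _ => ?_
    by_cases h : sig c r ≤ i <;> simp [avgVec, h]
  have h2 : ∑ i ∈ range n, (ν i : ℚ) ≤ ∑ i ∈ range n,
      ((if sig c r ≤ i then 0 else 1) * (ν i : ℚ) + if i = sig c r then 1 else 0) := by
    refine sum_le_sum fun i hi => ?_
    rw [mem_range] at hi
    by_cases h : sig c r ≤ i
    · rcases hfin with hf | hf <;> rw [hf i h hi] <;> by_cases hs : i = sig c r <;> simp [hs, h]
    · simp [h, show i ≠ sig c r by omega]
  have h3 : ∑ i ∈ range n, (if i = sig c r then (1 : ℚ) else 0) ≤ 1 := by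
    rw [sum_ite_eq']
    split_ifs <;> norm_num
  rw [h1, key, psum]
  rw [sum_add_distrib] at h2
  push_cast
  linarith

end Minuscule

/-- The hinge sum of a nonincreasing vector is a partial sum, hence is controlled by any vector
dominating all its partial sums. -/
lemma sum_hinge_le_of_psum_le (n : ℕ) (a y : ℕ → ℚ) (t : ℚ)
    (ha : ∀ i i', i ≤ i' → i' < n → a i' ≤ a i)
    (hle : ∀ i, 1 ≤ i → i ≤ n → psum a i ≤ psum y i) :
    ∑ i ∈ range n, (if t < a i then a i - t else 0) ≤ ∑ i ∈ range n, max (y i - t) 0 := by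
  obtain ⟨p, hpn, hp⟩ : ∃ p ≤ n, ∀ i < n, t < a i ↔ i < p := by
    by_cases h : ∃ i < n, a i ≤ t
    · classical
      refine ⟨Nat.find h, (Nat.find_spec h).1.le, fun i hi => ⟨fun hlt => ?_, fun hlt => ?_⟩⟩
      · by_contra! hge
        exact absurd ((ha _ _ hge hi).trans (Nat.find_spec h).2) (not_le.mpr hlt)
      · by_contra! hge
        exact Nat.find_min h hlt ⟨hi, hge⟩
    · push Not at h
      exact ⟨n, le_rfl, fun i hi => iff_of_true (h i hi) hi⟩
  have hpsum : psum a p ≤ psum y p := by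
    rcases Nat.eq_zero_or_pos p with rfl | hpos
    · simp [psum]
    · exact hle p hpos hpn
  calc ∑ i ∈ range n, (if t < a i then a i - t else 0)
      = ∑ i ∈ range p, (a i - t) := by
        rw [← sum_subset (range_mono hpn)]
        · exact sum_congr rfl fun i hi =>
            if_pos ((hp i ((mem_range.mp hi).trans_le hpn)).mpr (mem_range.mp hi))
        · intro i hi hi'
          exact if_neg (mt (hp i (mem_range.mp hi)).mp (by simpa using hi'))
    _ ≤ ∑ i ∈ range p, (y i - t) := by
        simp only [sum_sub_distrib]
        exact sub_le_sub_right hpsum _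
    _ ≤ ∑ i ∈ range p, max (y i - t) 0 := sum_le_sum fun i _ => le_max_left _ _
    _ ≤ ∑ i ∈ range n, max (y i - t) 0 :=
        sum_le_sum_of_subset_of_nonneg (range_mono hpn) fun i _ _ => le_max_right _ _

theorem stmt10 (n r j : ℕ) (hr : 0 < r) (c : ℕ → ℕ)
    (hpos : ∀ k < r, 0 < c k) (hsum : sig c r + j = n)
    (μ ν : ℕ → ℤ)
    -- μ is SO_{2n+1}-dominant
    (hμ : (∀ i i', i ≤ i' → i' < n → μ i' ≤ μ i) ∧ 0 ≤ μ (n - 1))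
    -- ν is M-dominant and M-minuscule of type B: within each of the first r
    -- batches, entries are nonincreasing and differ by at most 1, and
    (hM : ∀ i i', i ≤ i' → i' < sig c r → batchIdx c r i = batchIdx c r i' →
      ν i' ≤ ν i ∧ ν i ≤ ν i' + 1)
    -- the final batch equals (0, …, 0) or (1, 0, …, 0)
    (hfin : (∀ i, sig c r ≤ i → i < n → ν i = 0) ∨
            (∀ i, sig c r ≤ i → i < n → ν i = if i = sig c r then 1 else 0))
    -- ν_M is SO_{2n+1}-dominant: nonincreasing with last entry ≥ 0
    (hdom : (∀ i i', i ≤ i' → i' < n → avgVec c r n ν i' ≤ avgVec c r n ν i) ∧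
      0 ≤ avgVec c r n ν (n - 1))
    -- S_i(ν_M) ≤ S_i(μ) for 1 ≤ i ≤ n
    (hle : ∀ i, 1 ≤ i → i ≤ n →
      psum (avgVec c r n ν) i ≤ psum (fun m => (μ m : ℚ)) i)
    -- S_n(μ) - S_n(ν) is even
    (hpar : Even (psum μ n - psum ν n)) :
    -- ν lies in the convex hull of the vectors obtained from μ by permuting
    -- coordinates and changing the signs of an arbitrary subset of them
    (fun i : Fin n => (ν i : ℝ)) ∈
      convexHull ℝ {x : Fin n → ℝ |
        ∃ (π : Equiv.Perm (Fin n)) (ε : Fin n → ℝ),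
          (∀ i, ε i = 1 ∨ ε i = -1) ∧ ∀ i, x i = ε i * (μ (π i) : ℝ)} := by
  have hn : 1 ≤ n := by
    have : c 0 ≤ sig c r := single_le_sum (f := c) (fun _ _ => Nat.zero_le _) (mem_range.mpr hr)
    have := hpos 0 hr
    omega
  have hμ0 : ∀ i < n, 0 ≤ μ i := fun i hi => hμ.2.trans (hμ.1 _ _ (by omega) (by omega))
  have hfin01 : ∀ i, sig c r ≤ i → i < n → 0 ≤ ν i ∧ ν i ≤ 1 := by
    intro i h hi
    rcases hfin with hf | hf <;> rw [hf i h hi]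
    · simp
    · split_ifs <;> simp
  have hν0 : ∀ i < n, 0 ≤ ν i := by
    intro i hi
    rcases lt_or_ge i (sig c r) with hir | hir
    · by_contra! hlt
      have h1 := avgVec_lt_of_lt hM hi hir hlt
      have h2 := hdom.2.trans (hdom.1 i (n - 1) (by omega) (by omega))
      push_cast at h1
      linarith
    · exact (hfin01 i hir hi).1
  have htotal : psum ν n ≤ psum μ n := by
    have h1 := psum_le_psum_avgVec_add_one (n := n) hfin
    have h2 := hle n hn le_rfl
    have h3 : psum (fun m => (μ m : ℚ)) n = ((psum μ n : ℤ) : ℚ) := by simp [psum]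
    have h4 : psum ν n ≤ psum μ n + 1 := by
      rw [h3] at h2
      exact_mod_cast h1.trans (add_le_add_left h2 1)
    obtain ⟨k, hk⟩ := hpar
    omega
  have hhinge : ∀ m : ℤ, 0 ≤ m →
      ∑ i ∈ range n, max (ν i - m) 0 ≤ ∑ i ∈ range n, max (μ i - m) 0 := by
    intro m hm
    rcases hm.eq_or_lt with rfl | hm
    · have h : ∀ x : ℕ → ℤ, (∀ i < n, 0 ≤ x i) →
          ∑ i ∈ range n, max (x i - 0) 0 = psum x n := fun x hx =>
        sum_congr rfl fun i hi => by rw [sub_zero, max_eq_left (hx i (mem_range.mp hi))]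
      rw [h ν hν0, h μ hμ0]
      exact htotal
    · have h1 := sum_hinge_eq_sum_hinge_avgVec (n := n) hM
        (fun i h hi => (hfin01 i h hi).2) (show 1 ≤ m by omega)
      have h2 := sum_hinge_le_of_psum_le n _ _ (m : ℚ) hdom.1 hle
      rw [← h1] at h2
      exact_mod_cast h2
  have hmaj := sum_le_psum_of_hinge n μ ν hμ.1 hμ0 hhinge
  refine mem_convexHull_signed_perm n (fun i => (ν i : ℝ)) (fun i => (μ i : ℝ))
    (fun i hi => Int.cast_nonneg (hν0 i hi)) fun s hs => ?_
  have := hmaj s hs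
  simp only [psum] at this ⊢
  exact_mod_cast this
end

section
/- Let ν ∈ ℤ^n be M-dominant and M-minuscule of type D with respect to (n_1,…,n_r; j) (with j ≠ 1), and suppose ν_M is SO_{2n}-dominant. Then ν_i ≥ 0 for all 1 ≤ i ≤ n−1; moreover, unless j = 0 and n_r = 1, also ν_n ≥ 0. -/
open Finset

theorem batchIdx_eq_iff_of_pos {c : ℕ → ℕ} {r : ℕ} (hr : 0 < r) (i : ℕ) :
    batchIdx c r i = r ↔ sig c r ≤ i := by
  unfold batchIdx
  constructor
  · intro h
    exact (Nat.findGreatest_eq_iff.1 h).2.1 hr.ne'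
  · intro h
    exact le_antisymm (Nat.findGreatest_le r) (Nat.le_findGreatest le_rfl h)

theorem batchIdx_eq_pred {c : ℕ → ℕ} {r i : ℕ} (h₁ : sig c (r - 1) ≤ i) (h₂ : i < sig c r) :
    batchIdx c r i = r - 1 := by
  unfold batchIdx
  refine Nat.findGreatest_eq_iff.2 ⟨Nat.sub_le r 1, fun _ => h₁, fun k hk hkr => ?_⟩
  obtain rfl : k = r := by omega
  exact not_le.2 h₂

/-- A nonnegative batch average forces all entries of an `M`-minuscule batch to be nonnegative. -/
theorem nonneg_of_avgVec_nonneg {n r : ℕ} (hr : 0 < r) {c : ℕ → ℕ} {ν : ℕ → ℤ}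
    (hM : ∀ i i', i ≤ i' → i' < sig c r → batchIdx c r i = batchIdx c r i' →
      ν i' ≤ ν i ∧ ν i ≤ ν i' + 1)
    (hfin : (∀ i, sig c r ≤ i → i < n → ν i = 0) ∨
            (∀ i, sig c r ≤ i → i < n → ν i = if i = sig c r then 1 else 0))
    {i : ℕ} (hi : i < n) (havg : 0 ≤ avgVec c r n ν i) : 0 ≤ ν i := by
  rcases le_or_gt (sig c r) i with h | h
  · rcases hfin with hf | hf
    · rw [hf i h hi]
    · rw [hf i h hi]
      split_ifs <;> norm_num
  by_contra! hneg
  have hle : ∀ m, batchIdx c r m = batchIdx c r i → ν m ≤ 0 := by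
    intro m hm
    have hm' : m < sig c r := by
      by_contra! hge
      have := (batchIdx_eq_iff_of_pos hr m).2 hge
      exact not_le.2 h ((batchIdx_eq_iff_of_pos hr i).1 (hm ▸ this))
    rcases le_total m i with hmi | him
    · have := (hM m i hmi h hm).2
      omega
    · have := (hM i m him hm' hm.symm).1
      omega
  have hnum : (∑ m ∈ range n, if batchIdx c r m = batchIdx c r i then (ν m : ℚ) else 0) < 0 := by
    refine Finset.sum_neg' (fun m _ => ?_) ⟨i, mem_range.2 hi, ?_⟩
    · split_ifs with hm
      · exact_mod_cast hle m hm
      · exact le_rfl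
    · simpa using hneg
  have hden : (0 : ℚ) < ∑ m ∈ range n, if batchIdx c r m = batchIdx c r i then (1 : ℚ) else 0 := by
    refine Finset.sum_pos' (fun m _ => ?_) ⟨i, mem_range.2 hi, ?_⟩
    · split_ifs <;> norm_num
    · simp
  rw [avgVec, if_neg (not_le.2 h)] at havg
  exact not_lt.2 havg (div_neg_of_neg_of_pos hnum hden)

theorem stmt11 (n r j : ℕ) (hn : 2 ≤ n) (hr : 0 < r) (hj : j ≠ 1) (c : ℕ → ℕ)
    (hpos : ∀ k < r, 0 < c k) (hsum : sig c r + j = n) (ν : ℕ → ℤ)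
    -- ν is M-dominant and M-minuscule of type D: within each of the first r
    -- batches, entries are nonincreasing and differ by at most 1, and
    (hM : ∀ i i', i ≤ i' → i' < sig c r → batchIdx c r i = batchIdx c r i' →
      ν i' ≤ ν i ∧ ν i ≤ ν i' + 1)
    -- the final batch equals (0, …, 0) or (1, 0, …, 0)
    (hfin : (∀ i, sig c r ≤ i → i < n → ν i = 0) ∨
            (∀ i, sig c r ≤ i → i < n → ν i = if i = sig c r then 1 else 0))
    -- ν_M is SO_{2n}-dominant: nonincreasing and sum of last two entries ≥ 0
    (hdom : (∀ i i', i ≤ i' → i' < n → avgVec c r n ν i' ≤ avgVec c r n ν i) ∧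
      0 ≤ avgVec c r n ν (n - 2) + avgVec c r n ν (n - 1)) :
    (∀ i, i < n - 1 → 0 ≤ ν i) ∧
    (¬ (j = 0 ∧ c (r - 1) = 1) → 0 ≤ ν (n - 1)) := by
  have hmono := hdom.1 (n - 2) (n - 1) (by omega) (by omega)
  have hpen : 0 ≤ avgVec c r n ν (n - 2) := by linarith [hdom.2]
  refine ⟨fun i hi => ?_, fun hne => ?_⟩
  · exact nonneg_of_avgVec_nonneg hr hM hfin (by omega)
      (hpen.trans (hdom.1 i (n - 2) (by omega) (by omega)))
  · refine nonneg_of_avgVec_nonneg hr hM hfin (by omega) ?_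
    rcases Nat.eq_zero_or_pos j with hj0 | hj0
    · have hc : 2 ≤ c (r - 1) := by
        have := hpos (r - 1) (by omega)
        have : c (r - 1) ≠ 1 := fun h => hne ⟨hj0, h⟩
        omega
      have hsig : sig c r = sig c (r - 1) + c (r - 1) := by
        rw [sig, sig, ← Finset.sum_range_succ, Nat.sub_add_cancel hr]
      have h₁ : batchIdx c r (n - 1) = r - 1 := batchIdx_eq_pred (by omega) (by omega)
      have h₂ : batchIdx c r (n - 2) = r - 1 := batchIdx_eq_pred (by omega) (by omega)
      have heq : avgVec c r n ν (n - 1) = avgVec c r n ν (n - 2) := by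
        rw [avgVec, avgVec, if_neg (by omega), if_neg (by omega), h₁, h₂]
      rwa [heq]
    · rw [avgVec, if_pos (by omega)]
end
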